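/- Let q ≥ 2 and k, ℓ, n, t ≥ 1 be integers, let G be an abelian group, and let b = (b_1,...,b_{n+ℓ}) ∈ G^{n+ℓ} be a Sidon set of order t. Fix g ∈ G and let C = {x ∈ Z_q^n : b ⊙ σ_k(Δ_k(R_ℓ(x))) = g}. Then for all distinct x, x' ∈ C, B_{k,t}(R_ℓ(x)) ∩ B_{k,t}(R_ℓ(x')) = ∅; that is, C corrects t tandem duplications of length k in the ℓ-read channel. -/

import Mathlib

/-- The composition of a word over `Fin q`, as an element of `ℤ^q`:
it counts, for each letter `a`, the number of occurrences of `a`. -/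
def comp {q : ℕ} (w : List (Fin q)) : Fin q → ℤ := fun a => (w.count a : ℤ)

/-- The `ℓ`-read vector of a word over `Fin q`: a word of length `n + ℓ - 1`
over `ℤ^q` whose `p`-th entry is the composition of the window of the last `ℓ`
symbols ending at position `p` (symbols outside the word are omitted). -/
def readVec {q : ℕ} (ℓ : ℕ) (x : List (Fin q)) : List (Fin q → ℤ) :=
  (List.range (x.length + ℓ - 1)).map fun p => comp ((x.take (p + 1)).drop (p + 1 - ℓ))

/-- The `k`-step derivative of a word over an abelian group, with the
convention that entries at nonpositive positions are `0`. -/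
def kderiv {G : Type*} [AddCommGroup G] (k : ℕ) (y : List G) : List G :=
  (List.range y.length).map fun i => y.getD i 0 - if k ≤ i then y.getD (i - k) 0 else 0

/-- The lengths `(m_0, m_1, ..., m_s)` of the maximal (possibly empty) runs of
zeros in `y = 0^{m_0} y_1 0^{m_1} ⋯ y_s 0^{m_s}` with `y_1, ..., y_s ≠ 0`. -/
def zeroRuns {G : Type*} [Zero G] [DecidableEq G] (y : List G) : List ℕ :=
  (y.splitOnP fun a => decide (a ≠ 0)).map List.length

/-- `σ_k(y) = (⌊m_0/k⌋, ⌊m_1/k⌋, ..., ⌊m_s/k⌋)`. -/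
def sigmak {G : Type*} [Zero G] [DecidableEq G] (k : ℕ) (y : List G) : List ℕ :=
  (zeroRuns y).map fun m => m / k

/-- Interleave zero runs of the given lengths with the given (nonzero) letters:
`assemble (m_0 :: ... :: m_s) (y_1 :: ... :: y_s) = 0^{m_0} y_1 0^{m_1} ⋯ y_s 0^{m_s}`. -/
def assemble {G : Type*} [Zero G] : List ℕ → List G → List G
  | [], _ => []
  | m :: _, [] => List.replicate m (0 : G)
  | m :: ms, a :: as => List.replicate m (0 : G) ++ a :: assemble ms as

/-- `μ_k(y) = 0^{m_0 % k} y_1 0^{m_1 % k} ⋯ y_s 0^{m_s % k}`. -/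
def muk {G : Type*} [Zero G] [DecidableEq G] (k : ℕ) (y : List G) : List G :=
  assemble ((zeroRuns y).map fun m => m % k) (y.filter fun a => decide (a ≠ 0))

/-- The nucleus `N_{k,ℓ}(x) = μ_k(Δ_k(R_ℓ(x)))` of a word over `Fin q`. -/
def nucleus {q : ℕ} (k ℓ : ℕ) (x : List (Fin q)) : List (Fin q → ℤ) :=
  muk k (kderiv k (readVec ℓ x))

/-- A single tandem duplication of length `k`: `u v w ↦ u v v w` with `|v| = k`. -/
def TD {α : Type*} (k : ℕ) (y z : List α) : Prop :=
  ∃ u v w : List α, v.length = k ∧ y = u ++ (v ++ w) ∧ z = u ++ (v ++ (v ++ w))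

/-- `TDt k t y z` holds iff `z` arises from `y` by a sequence of exactly `t`
tandem duplications of length `k`, i.e. `y ⟹_k^t z`. -/
def TDt {α : Type*} (k : ℕ) : ℕ → List α → List α → Prop
  | 0 => fun y z => y = z
  | t + 1 => fun y z => ∃ w, TDt k t y w ∧ TD k w z

/-- The ball `B_{k,t}(y)`: all words obtained from `y` by at most `t` tandem
duplications of length `k`. -/
def Ball {α : Type*} (k t : ℕ) (y : List α) : Set (List α) :=
  {z | ∃ j ≤ t, TDt k j y z}

/-- `x` is `(k,ℓ)`-fine: it contains no `k`-periodic factor of length `2k+ℓ-1`. -/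
def Fine {q : ℕ} (k ℓ : ℕ) (x : List (Fin q)) : Prop :=
  ∀ i : ℕ, 1 ≤ i → i + 2 * k + ℓ - 2 ≤ x.length →
    (x.drop (i - 1)).take (k + ℓ - 1) ≠ (x.drop (i - 1 + k)).take (k + ℓ - 1)

/-- `y` contains the factor `0^k` (a run of `k` consecutive zeros). -/
def HasZeroBlock {G : Type*} [Zero G] (k : ℕ) (y : List G) : Prop :=
  ∃ j, j + k ≤ y.length ∧ (y.drop j).take k = List.replicate k (0 : G)

/-- `λ_{m,q}`: the largest real root of `x^{m+2} - q·x^{m+1} + q - 1`. -/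
noncomputable def lambdaRoot (m q : ℕ) : ℝ :=
  sSup {x : ℝ | x ^ (m + 2) - (q : ℝ) * x ^ (m + 1) + (q : ℝ) - 1 = 0}

/-- The dot product `a ⊙ b = Σ_{i=1}^{min(|a|,|b|)} a_i · b_i`. -/
def dot {G : Type*} [AddCommMonoid G] (a : List ℕ) (b : List G) : G :=
  (List.zipWith (fun m g => m • g) a b).sum

theorem kderiv_length {G : Type*} [AddCommGroup G] (k : ℕ) (y : List G) :
    (kderiv k y).length = y.length := by
  simp [kderiv]

theorem kderiv_eq_zipWith {G : Type*} [AddCommGroup G] (k : ℕ) (y : List G) :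
    kderiv k y = List.zipWith (fun a b => a - b) y (List.replicate k 0 ++ y) := by
  apply List.ext_getElem
  · simp [kderiv]
  · intro i h₁ h₂
    rw [kderiv_length] at h₁
    simp only [kderiv, List.getElem_map, List.getElem_range, List.getElem_zipWith,
      List.getD_eq_getElem?_getD, List.getElem?_eq_getElem h₁, Option.getD_some,
      List.getElem_append, List.length_replicate, List.getElem_replicate]
    by_cases h : k ≤ i
    · have h' : i - k < y.length := by omega
      simp [h, not_lt.mpr h, List.getElem?_eq_getElem h']
    · simp [h, not_le.mp h]

theorem kderiv_injective {G : Type*} [AddCommGroup G] {k : ℕ} (hk : 1 ≤ k) :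
    Function.Injective (kderiv k : List G → List G) := by
  intro y y' h
  have hlen : y.length = y'.length := by
    simpa [kderiv_length] using congrArg List.length h
  have key : ∀ i < y.length, y.getD i 0 = y'.getD i 0 := by
    intro i
    induction i using Nat.strong_induction_on with
    | _ i ih =>
      intro hi
      have hd := congrArg (fun l => l.getD i 0) h
      simp only [kderiv, List.getD_eq_getElem?_getD, List.getElem?_map, ← hlen,
        List.getElem?_range hi, Option.map_some, Option.getD_some] at hd ih ⊢
      by_cases hki : k ≤ i
      · simpa [hki, ih (i - k) (by omega) (by omega)] using hd
      · simpa [hki] using hd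
  refine List.ext_getElem hlen fun i hi hi' => ?_
  simpa [List.getD_eq_getElem?_getD, hi, hi'] using key i hi

/-- A tandem duplication of length `k` inserts the block `0^k` into the `k`-step derivative. -/
theorem TD.kderiv {G : Type*} [AddCommGroup G] {k : ℕ} {y z : List G} (h : TD k y z) :
    ∃ u w : List G, kderiv k y = u ++ w ∧ kderiv k z = u ++ (List.replicate k 0 ++ w) := by
  obtain ⟨u, v, w, hv, rfl, rfl⟩ := h
  obtain ⟨p, r, hpr, hp, hr⟩ : ∃ p r : List G,
      List.replicate k 0 ++ u = p ++ r ∧ p.length = u.length ∧ r.length = k :=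
    ⟨(List.replicate k 0 ++ u).take u.length, (List.replicate k 0 ++ u).drop u.length,
      (List.take_append_drop _ _).symm, by simp, by simp⟩
  refine ⟨List.zipWith (fun a b => a - b) u p ++ List.zipWith (fun a b => a - b) v r,
    List.zipWith (fun a b => a - b) w (v ++ w), ?_, ?_⟩
  · rw [kderiv_eq_zipWith, ← List.append_assoc (List.replicate k 0), hpr, List.append_assoc,
      List.zipWith_append hp.symm, List.zipWith_append (hv.trans hr.symm), List.append_assoc]
  · have hvv : List.zipWith (fun a b => a - b) v v = List.replicate k (0 : G) := by
      simp [List.zipWith_self, hv, List.map_const']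
    rw [kderiv_eq_zipWith, ← List.append_assoc (List.replicate k 0), hpr, List.append_assoc,
      List.zipWith_append hp.symm, List.zipWith_append (hv.trans hr.symm),
      List.zipWith_append rfl, hvv, List.append_assoc]

section ZeroRuns

variable {G : Type*} [Zero G] [DecidableEq G]

theorem zeroRuns_nil : zeroRuns ([] : List G) = [0] := by
  simp [zeroRuns]

theorem zeroRuns_cons_of_ne {a : G} (ha : a ≠ 0) (y : List G) :
    zeroRuns (a :: y) = 0 :: zeroRuns y := by
  simp [zeroRuns, List.splitOnP_cons_eq_if_modifyHead, ha]

theorem zeroRuns_zero_cons (y : List G) :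
    zeroRuns (0 :: y) = (zeroRuns y).modifyHead (· + 1) := by
  simp only [zeroRuns, List.splitOnP_cons_eq_if_modifyHead]
  cases List.splitOnP (fun a : G => decide (a ≠ 0)) y <;> simp

theorem zeroRuns_ne_nil (y : List G) : zeroRuns y ≠ [] := by
  simp [zeroRuns, List.splitOnP_ne_nil]

theorem zeroRuns_length_le (y : List G) : (zeroRuns y).length ≤ y.length + 1 := by
  induction y with
  | nil => simp [zeroRuns_nil]
  | cons a y ih =>
    by_cases ha : a = 0
    · subst ha
      simp [zeroRuns_zero_cons]
      omega
    · simpa [zeroRuns_cons_of_ne ha] using ih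

theorem assemble_zeroRuns (y : List G) :
    assemble (zeroRuns y) (y.filter fun a => decide (a ≠ 0)) = y := by
  induction y with
  | nil => simp [zeroRuns_nil, assemble]
  | cons a y ih =>
    by_cases ha : a = 0
    · subst ha
      obtain ⟨m, ms, h⟩ := List.exists_cons_of_ne_nil (zeroRuns_ne_nil y)
      rw [h] at ih
      simp only [zeroRuns_zero_cons, h, List.modifyHead_cons, ne_eq, not_true_eq_false,
        decide_false, Bool.false_eq_true, not_false_eq_true, List.filter_cons_of_neg]
      cases hf : y.filter fun a => decide (a ≠ 0) with
      | nil =>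
        rw [hf] at ih
        simpa [assemble, List.replicate_succ, hf] using ih
      | cons b bs =>
        rw [hf] at ih
        simp only [ne_eq] at hf
        simpa [assemble, List.replicate_succ, hf] using ih
    · simp only [zeroRuns_cons_of_ne ha, ne_eq, ha, not_false_eq_true, decide_true,
        List.filter_cons_of_pos, assemble, List.replicate_zero, List.nil_append]
      rw [ih]

theorem zeroRuns_replicate_append (k : ℕ) (w : List G) :
    zeroRuns (List.replicate k 0 ++ w) = (zeroRuns w).modifyHead (· + k) := by
  obtain ⟨m, ms, h⟩ := List.exists_cons_of_ne_nil (zeroRuns_ne_nil w)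
  induction k with
  | zero => simp [h]
  | succ k ih =>
    simp [List.replicate_succ, zeroRuns_zero_cons, ih, h]
    omega

theorem zeroRuns_insert (k : ℕ) (u w : List G) :
    ∃ e : List ℕ, e.length = (zeroRuns (u ++ w)).length ∧ e.sum = 1 ∧
      zeroRuns (u ++ (List.replicate k 0 ++ w)) =
        List.zipWith (fun m a => m + k * a) (zeroRuns (u ++ w)) e := by
  induction u with
  | nil =>
    obtain ⟨m, ms, h⟩ := List.exists_cons_of_ne_nil (zeroRuns_ne_nil w)
    refine ⟨1 :: List.replicate ms.length 0, by simp [h], by simp, ?_⟩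
    simp only [List.nil_append, zeroRuns_replicate_append, h]
    simp only [List.modifyHead_cons, List.zipWith_cons_cons, mul_one, List.cons.injEq, true_and]
    apply List.ext_getElem <;> simp
  | cons b u ih =>
    obtain ⟨e, he, hs, hz⟩ := ih
    by_cases hb : b = 0
    · subst hb
      refine ⟨e, by simpa [zeroRuns_zero_cons] using he, hs, ?_⟩
      obtain ⟨m, ms, h⟩ := List.exists_cons_of_ne_nil (zeroRuns_ne_nil (u ++ w))
      rw [h] at he hz
      obtain ⟨c, cs, rfl⟩ := List.exists_cons_of_length_eq_add_one he
      simp only [List.cons_append, zeroRuns_zero_cons, hz, h, List.zipWith_cons_cons,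
        List.modifyHead_cons, List.cons.injEq, and_true]
      omega
    · exact ⟨0 :: e, by simpa [zeroRuns_cons_of_ne hb] using he, by simpa using hs,
        by simp [zeroRuns_cons_of_ne hb, hz]⟩

end ZeroRuns

theorem zipWith_add_mul_zipWith_add (k : ℕ) (s e f : List ℕ) :
    List.zipWith (fun m a => m + k * a) (List.zipWith (fun m a => m + k * a) s e) f =
      List.zipWith (fun m a => m + k * a) s (List.zipWith (· + ·) e f) := by
  induction s generalizing e f with
  | nil => simp
  | cons m s ih =>
    cases e <;> cases f <;> simp [ih]
    ring

theorem sum_zipWith_add {e f : List ℕ} (h : e.length = f.length) :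
    (List.zipWith (· + ·) e f).sum = e.sum + f.sum := by
  induction e generalizing f with
  | nil => cases f <;> simp_all
  | cons a e ih =>
    cases f with
    | nil => simp at h
    | cons c f =>
      simp [ih (f := f) (by simpa using h)]
      omega

theorem zipWith_add_mul_left_cancel {k : ℕ} {s s' e : List ℕ} (h : e.length = s.length)
    (h' : e.length = s'.length)
    (heq : List.zipWith (fun m a => m + k * a) s e = List.zipWith (fun m a => m + k * a) s' e) :
    s = s' := by
  induction e generalizing s s' with
  | nil =>
    rw [List.eq_nil_of_length_eq_zero h.symm, List.eq_nil_of_length_eq_zero h'.symm]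
  | cons a e ih =>
    obtain ⟨m, s, rfl⟩ := List.exists_cons_of_length_eq_add_one h.symm
    obtain ⟨m', s', rfl⟩ := List.exists_cons_of_length_eq_add_one h'.symm
    simp only [List.zipWith_cons_cons, List.cons.injEq, add_left_inj] at heq
    rw [heq.1, ih (by simpa using h) (by simpa using h') heq.2]

theorem map_div_zipWith_add_mul {k : ℕ} (hk : 1 ≤ k) (s e : List ℕ) :
    (List.zipWith (fun m a => m + k * a) s e).map (fun m => m / k) =
      List.zipWith (· + ·) (s.map fun m => m / k) e := by
  simp [List.map_zipWith, List.zipWith_map_left, Nat.add_mul_div_left _ _ hk]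

theorem dot_zipWith_add {G : Type*} [AddCommMonoid G] {a e : List ℕ} (h : a.length = e.length)
    (b : List G) : dot (List.zipWith (· + ·) a e) b = dot a b + dot e b := by
  induction a generalizing e b with
  | nil => cases e <;> simp_all [dot]
  | cons m a ih =>
    obtain ⟨c, e, rfl⟩ := List.exists_cons_of_length_eq_add_one h.symm
    cases b with
    | nil => simp [dot]
    | cons g b =>
      have := ih (e := e) (by simpa using h) b
      simp only [dot] at this
      simp only [dot, List.zipWith_cons_cons, List.sum_cons, this, add_smul]
      abel

theorem dot_append_replicate_zero {G : Type*} [AddCommMonoid G] (a : List ℕ) (r : ℕ)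
    (b : List G) : dot (a ++ List.replicate r 0) b = dot a b := by
  induction a generalizing b with
  | nil =>
    simp only [List.nil_append]
    induction r generalizing b with
    | zero => simp
    | succ r ih =>
      cases b with
      | nil => simp [dot]
      | cons g b =>
        have := ih b
        simp only [dot] at this
        simp [dot, List.replicate_succ, this]
  | cons m a ih =>
    cases b with
    | nil => simp [dot]
    | cons g b =>
      have := ih b
      simp only [dot] at this
      simp [dot, this]

theorem TDt.zeroRuns_kderiv {G : Type*} [AddCommGroup G] [DecidableEq G] {k j : ℕ}
    {y z : List G} (h : TDt k j y z) :
    (kderiv k z).filter (fun a => decide (a ≠ 0)) =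
        (kderiv k y).filter (fun a => decide (a ≠ 0)) ∧
      ∃ e : List ℕ, e.length = (zeroRuns (kderiv k y)).length ∧ e.sum = j ∧
        zeroRuns (kderiv k z) =
          List.zipWith (fun m a => m + k * a) (zeroRuns (kderiv k y)) e := by
  induction j generalizing z with
  | zero =>
    obtain rfl : y = z := h
    refine ⟨rfl, List.replicate (zeroRuns (kderiv k y)).length 0, by simp, by simp, ?_⟩
    apply List.ext_getElem <;> simp
  | succ j ih =>
    obtain ⟨v, hv, hvz⟩ := h
    obtain ⟨hf, e, he, hs, hz⟩ := ih hv
    obtain ⟨u, w, huw, hz'⟩ := hvz.kderiv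
    obtain ⟨c, hc, hcs, hcz⟩ := zeroRuns_insert k u w
    rw [← huw] at hc hcz
    rw [← hz'] at hcz
    have hce : e.length = c.length := by
      rw [hc, hz, List.length_zipWith, he, min_self]
    refine ⟨?_, List.zipWith (· + ·) e c, by simp [← hce, he], ?_, ?_⟩
    · rw [← hf, hz', huw]
      simp
    · rw [sum_zipWith_add hce, hs, hcs]
    · rw [hcz, hz, zipWith_add_mul_zipWith_add]

theorem comp_append {q : ℕ} (v w : List (Fin q)) : comp (v ++ w) = comp v + comp w := by
  funext a
  simp [comp]

theorem comp_singleton_injective {q : ℕ} {a a' : Fin q} (h : comp [a] = comp [a']) : a = a' := by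
  have := congrFun h a
  by_contra hne
  simp [comp, Ne.symm hne] at this

theorem readVec_length {q : ℕ} (ℓ : ℕ) (x : List (Fin q)) :
    (readVec ℓ x).length = x.length + ℓ - 1 := by
  simp [readVec]

theorem readVec_inj {q ℓ : ℕ} (hl : 1 ≤ ℓ) {x x' : List (Fin q)} (hlen : x.length = x'.length)
    (h : readVec ℓ x = readVec ℓ x') : x = x' := by
  have key : ∀ i ≤ x.length, x.take i = x'.take i := by
    intro i
    induction i with
    | zero => simp
    | succ i ih =>
      intro hi
      have hi' : i < x'.length := by omega
      have hp := congrArg (fun l => l[i]?) h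
      have htake := ih (by omega)
      simp only [readVec, List.getElem?_map, ← hlen,
        List.getElem?_range (show i < x.length + ℓ - 1 by omega), Option.map_some,
        Option.some.injEq] at hp
      rw [List.take_succ_eq_append_getElem (show i < x.length by omega),
        List.take_succ_eq_append_getElem hi', htake] at hp ⊢
      have hle : i + 1 - ℓ ≤ (x'.take i).length := by
        rw [List.length_take]
        omega
      rw [List.drop_append_of_le_length hle, List.drop_append_of_le_length hle, comp_append,
        comp_append] at hp
      rw [comp_singleton_injective (add_left_cancel hp)]
  have := key x.length le_rfl
  rwa [List.take_length, hlen, List.take_length] at this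

/-- the Sidon-set construction corrects `t` tandem duplications
of length `k` in the `ℓ`-read channel: if `b` is a Sidon set of order `t` with
`n + ℓ` elements and `C = {x : b ⊙ σ_k(Δ_k(R_ℓ(x))) = g}`, then distinct
codewords of `C` have disjoint balls `B_{k,t}`. -/
theorem stmt_17 {G : Type*} [AddCommGroup G] (q k ℓ n t : ℕ)
    (hq : 2 ≤ q) (hk : 1 ≤ k) (hl : 1 ≤ ℓ) (hn : 1 ≤ n) (ht : 1 ≤ t)
    (b : List G) (hb : b.length = n + ℓ)
    (hSidon : ∀ a a' : List ℕ, a.length = n + ℓ → a'.length = n + ℓ →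
      a.sum ≤ t → a'.sum ≤ t → dot a b = dot a' b → a = a')
    (g : G) (x x' : Fin n → Fin q)
    (hx : dot (sigmak k (kderiv k (readVec ℓ (List.ofFn x)))) b = g)
    (hx' : dot (sigmak k (kderiv k (readVec ℓ (List.ofFn x')))) b = g)
    (hne : x ≠ x') :
    Ball k t (readVec ℓ (List.ofFn x)) ∩ Ball k t (readVec ℓ (List.ofFn x')) = ∅ := by
  rw [Set.eq_empty_iff_forall_notMem]
  rintro z ⟨⟨j, hj, hz⟩, ⟨j', hj', hz'⟩⟩
  apply hne
  obtain ⟨hf, e, he, hs, hr⟩ := hz.zeroRuns_kderiv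
  obtain ⟨hf', e', he', hs', hr'⟩ := hz'.zeroRuns_kderiv
  have hle := zeroRuns_length_le (kderiv k (readVec ℓ (List.ofFn x)))
  have hlen := congrArg List.length (hr.symm.trans hr')
  simp only [List.length_zipWith, he, he', min_self] at hlen
  simp only [kderiv_length, readVec_length, List.length_ofFn] at hle
  have hee : e.length = e'.length := by omega
  have hsig := congrArg (fun s => dot (s.map fun m => m / k) b) (hr.symm.trans hr')
  simp only [map_div_zipWith_add_mul hk] at hsig
  rw [dot_zipWith_add (by simp [he]), dot_zipWith_add (by simp [he'])] at hsig
  simp only [sigmak] at hx hx'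
  rw [hx, hx', add_right_inj] at hsig
  have hpad := hSidon (e ++ List.replicate (n + ℓ - e.length) 0)
    (e' ++ List.replicate (n + ℓ - e.length) 0)
    (by simp; omega) (by simp; omega) (by simpa [hs] using hj) (by simpa [hs'] using hj')
    (by simpa only [dot_append_replicate_zero] using hsig)
  obtain rfl : e = e' := List.append_cancel_right hpad
  have hruns := zipWith_add_mul_left_cancel he he' (hr.symm.trans hr')
  have hder : kderiv k (readVec ℓ (List.ofFn x)) = kderiv k (readVec ℓ (List.ofFn x')) := by
    rw [← assemble_zeroRuns (kderiv k (readVec ℓ (List.ofFn x))), ← hf, hf', hruns,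
      assemble_zeroRuns]
  exact List.ofFn_injective (readVec_inj hl (by simp) (kderiv_injective hk hder))
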